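/- (Microscopic parts at zeros, parallel chords.) Let φ be a Jacob's ladder on [T₀,∞) with k₁T ≤ φ(T) ≤ k₂T for all T ≥ T₀ (for some constants 0 < k₁ ≤ k₂), and assume the Balasubramanian formula: for every ε > 0, ∫₀^T Z(t)² dt = T ln T + (2c − 1 − ln 2π)T + O(T^{1/3+ε}) as T → ∞. Fix ε > 0. Then, as γ → ∞ through the zeros of ζ(1/2+it) (i.e. ζ(1/2+iγ) = 0), uniformly over all points γ < N < M < ρ with ρ ≤ γ + γ^{1/3+2ε} such that the chord of the curve y = φ(t)/2 over [N, M] is parallel to the chord over [γ, ρ], i.e. [φ(M) − φ(N)]/(M − N) = [φ(ρ) − φ(γ)]/(ρ − γ), one has ∫_N^M Z(t)² dt = [(M−N)·ln(φ(N)/2) − a(M−N)]·tan β(γ,ρ) + O(γ^{−(1/3−4ε)}), where tan β(γ,ρ) = [φ(ρ) − φ(γ)]/(2(ρ − γ)). -/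

import Mathlib

open Real MeasureTheory Filter

/-- `Z(t)²`, i.e. `|ζ(1/2 + it)|²`. -/
noncomputable def Z2 (t : ℝ) : ℝ := ‖riemannZeta (1/2 + Complex.I * t)‖ ^ 2

/-- The constant `a = ln(2π) − 1 − c`, where `c` is the Euler–Mascheroni constant. -/
noncomputable def aConst : ℝ := Real.log (2 * Real.pi) - 1 - Real.eulerMascheroniConstant

theorem continuous_Z2 : Continuous Z2 := by
  unfold Z2
  refine ((continuous_iff_continuousAt.2 fun t => ?_).norm).pow 2
  have h : (1/2 + Complex.I * t : ℂ) ≠ 1 := by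
    intro h
    have := congrArg Complex.re h
    norm_num at this
  exact ContinuousAt.comp (f := fun t : ℝ => (1/2 + Complex.I * t : ℂ))
    (differentiableAt_riemannZeta h).continuousAt (by fun_prop)

theorem integral_Z2_eq_sub (N M : ℝ) :
    ∫ t in N..M, Z2 t = (∫ t in (0:ℝ)..M, Z2 t) - ∫ t in (0:ℝ)..N, Z2 t :=
  (intervalIntegral.integral_interval_sub_left (continuous_Z2.intervalIntegrable _ _)
    (continuous_Z2.intervalIntegrable _ _)).symm

theorem mul_log_sub_ge {x y : ℝ} (hx : 0 < x) (hy : 0 < y) :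
    (Real.log x + 1) * (y - x) ≤ y * Real.log y - x * Real.log x := by
  have h := Real.log_le_sub_one_of_pos (div_pos hx hy)
  rw [Real.log_div hx.ne' hy.ne'] at h
  have h2 := mul_le_mul_of_nonneg_left h hy.le
  have h3 : y * (x / y - 1) = x - y := by field_simp
  rw [h3] at h2
  nlinarith

theorem mul_log_sub_le {x y : ℝ} (hx : 0 < x) (hy : 0 < y) :
    y * Real.log y - x * Real.log x ≤ (Real.log x + 1) * (y - x) + (y - x) ^ 2 / x := by
  have h := Real.log_le_sub_one_of_pos (div_pos hy hx)
  rw [Real.log_div hy.ne' hx.ne'] at h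
  have h2 := mul_le_mul_of_nonneg_left h hy.le
  have h3 : y * (y / x - 1) = (y - x) + (y - x) ^ 2 / x := by field_simp; ring
  rw [h3] at h2
  nlinarith

theorem log_div_self_le_rpow {γ T ε : ℝ} (hγ : 1 ≤ γ) (hT : γ ≤ T) (hε : 0 < ε) :
    Real.log T / T ≤ 3 / 2 * γ ^ (-((1:ℝ)/3 - 4*ε)) := by
  have hT0 : 0 < T := by linarith
  have h := Real.log_le_rpow_div hT0.le (show (0:ℝ) < 2/3 by norm_num)
  calc Real.log T / T ≤ (T ^ (2/3:ℝ) / (2/3)) / T := by gcongr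
    _ = 3 / 2 * T ^ (-(1/3) : ℝ) := by
      rw [show (-(1/3) : ℝ) = 2/3 - 1 by norm_num, Real.rpow_sub_one hT0.ne']; ring
    _ ≤ 3 / 2 * γ ^ (-(1/3) : ℝ) := by
      gcongr 3 / 2 * ?_
      exact Real.rpow_le_rpow_of_nonpos (by linarith) hT (by norm_num)
    _ ≤ _ := by
      gcongr 3 / 2 * ?_
      exact Real.rpow_le_rpow_of_exponent_le hγ (by linarith)

set_option maxHeartbeats 800000 in
/-- A Jacob's ladder grows at most linearly over windows of length `γ ^ (1/3 + 2ε)`. -/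
theorem exists_ladder_increment_le
    (φ : ℝ → ℝ) (T₀ : ℝ) (hpos : ∀ T ≥ T₀, 0 < φ T)
    (hladder : ∃ c₀ C : ℝ, ∀ T ≥ T₀,
      |(∫ t in (0:ℝ)..T, Z2 t) - (φ T / 2) * Real.log (φ T / 2)
        - (Real.eulerMascheroniConstant - Real.log (2 * Real.pi)) * (φ T / 2) - c₀|
        ≤ C * Real.log T / T)
    (k₁ k₂ : ℝ) (hk₁ : 0 < k₁) (hk₁₂ : k₁ ≤ k₂)
    (hgrowth : ∀ T ≥ T₀, k₁ * T ≤ φ T ∧ φ T ≤ k₂ * T)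
    (hBal : ∀ ε > (0:ℝ), ∃ C T₁ : ℝ, ∀ T ≥ T₁,
      |(∫ t in (0:ℝ)..T, Z2 t) - T * Real.log T
        - (2 * Real.eulerMascheroniConstant - 1 - Real.log (2 * Real.pi)) * T|
        ≤ C * T ^ ((1:ℝ)/3 + ε))
    (ε : ℝ) (hε : 0 < ε) :
    ∃ A Γ : ℝ, ∀ γ ≥ Γ,
      (φ (γ + γ ^ ((1:ℝ)/3 + 2*ε)) - φ γ) / 2 ≤ A * γ ^ ((1:ℝ)/3 + 2*ε) := by
  rcases le_or_gt 1 ((1:ℝ)/3 + 2*ε) with hbig | hsmall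
  · refine ⟨k₂, max 1 T₀, fun γ hγ => ?_⟩
    have h1 : 1 ≤ γ := le_trans (le_max_left _ _) hγ
    have h2 : T₀ ≤ γ := le_trans (le_max_right _ _) hγ
    have hU : γ ≤ γ ^ ((1:ℝ)/3 + 2*ε) := by
      simpa using Real.rpow_le_rpow_of_exponent_le h1 hbig
    set U := γ ^ ((1:ℝ)/3 + 2*ε)
    have h3 := (hgrowth (γ + U) (by linarith)).2
    have h4 := hpos γ h2
    nlinarith
  obtain ⟨c₀, C, hC⟩ := hladder
  obtain ⟨D, T₁, hD⟩ := hBal ε hε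
  set K := Real.eulerMascheroniConstant - Real.log (2 * Real.pi) with hK
  set K₂ := 2 * Real.eulerMascheroniConstant - 1 - Real.log (2 * Real.pi) with hK₂
  have hlog := Real.tendsto_log_atTop.eventually_ge_atTop
    (max 1 (max (2 * |Real.log (k₁ / 2) + 1 + K|) (2 + |K₂| + 3 * |D| + 2 * |C|)))
  obtain ⟨Γ, hΓ⟩ := eventually_atTop.1 hlog
  refine ⟨4, max Γ (max 1 (max T₀ T₁)), fun γ hγ => ?_⟩
  simp only [ge_iff_le, max_le_iff] at hγ hΓ
  obtain ⟨g0, g1, g2, g3⟩ := hγ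
  obtain ⟨l1, l2, l3⟩ := hΓ γ g0
  have γpos : 0 < γ := by linarith
  have hU1 : 1 ≤ γ ^ ((1:ℝ)/3 + 2*ε) := Real.one_le_rpow g1 (by linarith)
  have hUγ : γ ^ ((1:ℝ)/3 + 2*ε) ≤ γ := by
    simpa using Real.rpow_le_rpow_of_exponent_le g1 hsmall.le
  have hpU : γ ^ ((1:ℝ)/3 + ε) ≤ γ ^ ((1:ℝ)/3 + 2*ε) :=
    Real.rpow_le_rpow_of_exponent_le g1 (by linarith)
  set U := γ ^ ((1:ℝ)/3 + 2*ε)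
  have hR : (γ + U) ^ ((1:ℝ)/3 + ε) ≤ 2 * U := by
    calc (γ + U) ^ ((1:ℝ)/3 + ε) ≤ (2 * γ) ^ ((1:ℝ)/3 + ε) := by gcongr; linarith
      _ = 2 ^ ((1:ℝ)/3 + ε) * γ ^ ((1:ℝ)/3 + ε) := Real.mul_rpow (by norm_num) γpos.le
      _ ≤ 2 ^ (1:ℝ) * U := by
        gcongr
        · norm_num
        · linarith
      _ = 2 * U := by simp
  have hRpos : 0 < γ + U := by linarith
  have ladder_err : ∀ T ≥ γ, C * Real.log T / T ≤ |C| := by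
    intro T hT
    have hT0 : 0 < T := by linarith
    have q0 : 0 ≤ Real.log T := Real.log_nonneg (by linarith)
    rw [div_le_iff₀ hT0]
    have q1 : Real.log T ≤ T := (Real.log_le_sub_one_of_pos hT0).trans (by linarith)
    calc C * Real.log T ≤ |C| * Real.log T := by gcongr; exact le_abs_self C
      _ ≤ |C| * T := by gcongr
  have a1 := abs_le.1 ((hC γ g2).trans (ladder_err γ le_rfl))
  have a2 := abs_le.1 ((hC (γ + U) (by linarith)).trans (ladder_err (γ + U) (by linarith)))
  have d1 : D * γ ^ ((1:ℝ)/3 + ε) ≤ |D| * U := by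
    calc _ ≤ |D| * γ ^ ((1:ℝ)/3 + ε) := by gcongr; exact le_abs_self D
      _ ≤ _ := by gcongr
  have d2 : D * (γ + U) ^ ((1:ℝ)/3 + ε) ≤ |D| * (2 * U) := by
    calc _ ≤ |D| * (γ + U) ^ ((1:ℝ)/3 + ε) := by gcongr; exact le_abs_self D
      _ ≤ _ := by gcongr
  have b1 := abs_le.1 ((hD γ g3).trans d1)
  have b2 := abs_le.1 ((hD (γ + U) (by linarith)).trans d2)
  have x1 := hpos γ g2
  have x2 := hpos (γ + U) (by linarith)
  have e1 := mul_log_sub_ge (half_pos x1) (half_pos x2)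
  have e2 := mul_log_sub_le γpos hRpos
  have e3 : (γ + U - γ) ^ 2 / γ ≤ U := by
    rw [div_le_iff₀ γpos]; nlinarith
  have hlow : Real.log γ + Real.log (k₁ / 2) ≤ Real.log (φ γ / 2) := by
    rw [← Real.log_mul γpos.ne' (by positivity)]
    refine Real.log_le_log (by positivity) ?_
    linarith [(hgrowth γ g2).1]
  have f1 := neg_abs_le (Real.log (k₁ / 2) + 1 + K)
  have hslope : Real.log γ / 2 ≤ Real.log (φ γ / 2) + 1 + K := by linarith
  have hK₂U : K₂ * U ≤ |K₂| * U := by gcongr; exact le_abs_self _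
  have hCU : |C| ≤ |C| * U := le_mul_of_one_le_right (abs_nonneg C) hU1
  have hl3 : (2 + |K₂| + 3 * |D| + 2 * |C|) * U ≤ Real.log γ * U := by gcongr
  have hkey : (Real.log (φ γ / 2) + 1 + K) * ((φ (γ + U) - φ γ) / 2)
      ≤ 2 * Real.log γ * U := by
    have : (Real.log (φ γ / 2) + 1 + K) * ((φ (γ + U) - φ γ) / 2)
      = (Real.log (φ γ / 2) + 1) * (φ (γ + U) / 2 - φ γ / 2)
        + (K * (φ (γ + U) / 2) - K * (φ γ / 2)) := by ring
    rw [this]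
    linarith
  by_contra! hcon
  have hΔ : 0 ≤ (φ (γ + U) - φ γ) / 2 := by linarith
  have h1 := mul_le_mul_of_nonneg_right hslope hΔ
  have h2 := mul_lt_mul_of_pos_left hcon (show 0 < Real.log γ / 2 by linarith)
  linarith

theorem microscopic_parts_parallel_chords
    (φ : ℝ → ℝ) (T₀ : ℝ)
    (hcont : ContinuousOn φ (Set.Ici T₀))
    (hmono : StrictMonoOn φ (Set.Ici T₀))
    (hpos : ∀ T ≥ T₀, 0 < φ T)
    (hladder : ∃ c₀ C : ℝ, ∀ T ≥ T₀,
      |(∫ t in (0:ℝ)..T, Z2 t) - (φ T / 2) * Real.log (φ T / 2)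
        - (Real.eulerMascheroniConstant - Real.log (2 * Real.pi)) * (φ T / 2) - c₀|
        ≤ C * Real.log T / T)
    (k₁ k₂ : ℝ) (hk₁ : 0 < k₁) (hk₁₂ : k₁ ≤ k₂)
    (hgrowth : ∀ T ≥ T₀, k₁ * T ≤ φ T ∧ φ T ≤ k₂ * T)
    (hBal : ∀ ε > (0:ℝ), ∃ C T₁ : ℝ, ∀ T ≥ T₁,
      |(∫ t in (0:ℝ)..T, Z2 t) - T * Real.log T
        - (2 * Real.eulerMascheroniConstant - 1 - Real.log (2 * Real.pi)) * T|
        ≤ C * T ^ ((1:ℝ)/3 + ε))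
    (ε : ℝ) (hε : 0 < ε) :
    ∃ C Γ : ℝ, ∀ γ ≥ Γ, riemannZeta (1/2 + Complex.I * γ) = 0 →
      ∀ ρ N M : ℝ, γ < N → N < M → M < ρ → ρ ≤ γ + γ ^ ((1:ℝ)/3 + 2*ε) →
      (φ M - φ N) / (M - N) = (φ ρ - φ γ) / (ρ - γ) →
      |(∫ t in N..M, Z2 t)
        - ((M - N) * Real.log (φ N / 2) - aConst * (M - N))
            * ((φ ρ - φ γ) / (2 * (ρ - γ)))|
        ≤ C * γ ^ (-((1:ℝ)/3 - 4*ε)) := by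
  obtain ⟨A, Γ, hA⟩ := exists_ladder_increment_le φ T₀ hpos hladder k₁ k₂ hk₁ hk₁₂ hgrowth hBal ε hε
  obtain ⟨c₀, C, hC⟩ := hladder
  refine ⟨2 * A ^ 2 / k₁ + 3 * |C|, max Γ (max 1 T₀), ?_⟩
  intro γ hγ _ ρ N M hγN hNM hMρ hρ hchord
  simp only [ge_iff_le, max_le_iff] at hγ
  obtain ⟨g0, g1, g2⟩ := hγ
  have γpos : 0 < γ := by linarith
  have hinc := hA γ g0
  have hUsq : (γ ^ ((1:ℝ)/3 + 2*ε)) ^ 2 / γ = γ ^ (-((1:ℝ)/3 - 4*ε)) := by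
    rw [← Real.rpow_natCast, ← Real.rpow_mul γpos.le, ← Real.rpow_sub_one γpos.ne']
    congr 1; push_cast; ring
  have ladder_err : ∀ T ≥ γ, C * Real.log T / T
      ≤ |C| * (3 / 2 * γ ^ (-((1:ℝ)/3 - 4*ε))) := by
    intro T hT
    have q0 : 0 ≤ Real.log T / T :=
      div_nonneg (Real.log_nonneg (by linarith)) (by linarith)
    rw [mul_div_assoc]
    calc C * (Real.log T / T) ≤ |C| * (Real.log T / T) := by gcongr; exact le_abs_self C
      _ ≤ _ := by gcongr; exact log_div_self_le_rpow g1 hT hε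
  have a1 := abs_le.1 ((hC N (by linarith)).trans (ladder_err N hγN.le))
  have a2 := abs_le.1 ((hC M (by linarith)).trans (ladder_err M (by linarith)))
  have m1 : φ γ < φ N := hmono (Set.mem_Ici.2 g2) (Set.mem_Ici.2 (by linarith)) hγN
  have m2 : φ N < φ M :=
    hmono (Set.mem_Ici.2 (by linarith)) (Set.mem_Ici.2 (by linarith)) hNM
  have m3 : φ M ≤ φ (γ + γ ^ ((1:ℝ)/3 + 2*ε)) :=
    hmono.monotoneOn (Set.mem_Ici.2 (by linarith)) (Set.mem_Ici.2 (by linarith)) (by linarith)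
  have x1 := hpos N (by linarith)
  have x2 := hpos M (by linarith)
  have e1 := mul_log_sub_ge (half_pos x1) (half_pos x2)
  have e2 := mul_log_sub_le (half_pos x1) (half_pos x2)
  have hquad : (φ M / 2 - φ N / 2) ^ 2 / (φ N / 2)
      ≤ 2 * A ^ 2 / k₁ * γ ^ (-((1:ℝ)/3 - 4*ε)) := by
    calc (φ M / 2 - φ N / 2) ^ 2 / (φ N / 2)
        ≤ (A * γ ^ ((1:ℝ)/3 + 2*ε)) ^ 2 / (k₁ * γ / 2) := by
          gcongr
          · linarith
          · linarith
          · nlinarith [(hgrowth N (by linarith)).1]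
      _ = 2 * A ^ 2 / k₁ * ((γ ^ ((1:ℝ)/3 + 2*ε)) ^ 2 / γ) := by field_simp
      _ = _ := by rw [hUsq]
  have hmain : ((M - N) * Real.log (φ N / 2) - aConst * (M - N))
            * ((φ ρ - φ γ) / (2 * (ρ - γ)))
      = (Real.log (φ N / 2) + 1) * (φ M / 2 - φ N / 2)
        + (Real.eulerMascheroniConstant - Real.log (2 * Real.pi)) * (φ M / 2 - φ N / 2) := by
    have h1 : (φ ρ - φ γ) / (2 * (ρ - γ)) = (φ ρ - φ γ) / (ρ - γ) / 2 := by
      rw [div_div, mul_comm]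
    have h2 : M - N ≠ 0 := by linarith
    rw [h1, ← hchord, aConst]
    field_simp
    ring
  rw [hmain, integral_Z2_eq_sub, abs_le]
  constructor
  · have h0 : 0 ≤ 2 * A ^ 2 / k₁ * γ ^ (-((1:ℝ)/3 - 4*ε)) := by positivity
    nlinarith
  · nlinarith
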